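/- Assume k ≥ 2. Let m_opt_bl ∈ {1, …, N} satisfy B_k(m_opt_bl) ≤ B_k(m) for all m ∈ {1, …, N}, and assume B_k(m_opt_bl) < k − 1. Then m_opt_bl ≤ ⌈(N+1)/2⌉, and there exists μ_ub_bl > 0 such that for every μ' with 0 < μ' < μ_ub_bl there exists τ > 0 such that for every SNR with 0 < SNR < τ and every finite S ⊆ Fin N with |S| = m_opt_bl, the GLR quantities computed with parameter μ' satisfy ξ₁(S) + (1/SNR)·ξ₂ᵇˡ(S) < ξ₁(Fin N) + (1/SNR)·ξ₂ᵇˡ(Fin N); that is, under k-bandlimited noise any sample set of size m_opt_bl is better than full observation. -/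

import Mathlib

open Matrix

/-- Squared Frobenius norm `‖A‖_F² = trace(Aᵀ A)`. -/
noncomputable def frobSq {m n : Type*} [Fintype m] [Fintype n] (A : Matrix m n ℝ) : ℝ :=
  Matrix.trace (Aᵀ * A)

/-- `ω(x) = (√x + 1/√x)²/4`, from the Kantorovich inequality. -/
noncomputable def omegaFn (x : ℝ) : ℝ := (Real.sqrt x + 1 / Real.sqrt x) ^ 2 / 4

/-- The `j`-th eigenvalue `λⱼ` of the Laplacian, 1-indexed (with `λⱼ = 0` for `j ≤ 0` since
`λ₁ = 0`, and `0` beyond `N`). -/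
noncomputable def eig1 {N : ℕ} (lam : Fin N → ℝ) (j : ℕ) : ℝ :=
  if h : j - 1 < N then lam ⟨j - 1, h⟩ else 0

/-- `B_k(m) = r_bl·(N/m) + ∑_{i=2}^{m} ω(max(1, λ_{k+2−i}/λᵢ))` where `r_bl = ω(λ_k/λ₂)`. -/
noncomputable def Bbl {N : ℕ} (lam : Fin N → ℝ) (k m : ℕ) : ℝ :=
  omegaFn (eig1 lam k / eig1 lam 2) * ((N : ℝ) / (m : ℝ)) +
    ∑ i ∈ Finset.Icc 2 m, omegaFn (max 1 (eig1 lam (k + 2 - i) / eig1 lam i))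


noncomputable def Hf (l : ℕ → ℝ) (i j : ℕ) : ℝ :=
  if i < j then (l i - l j) ^ 2 / (l i * l j) else 0

noncomputable def cf (l : ℕ → ℝ) (s t : ℕ) : ℝ :=
  (Hf l s t - Hf l (s+1) t) - (Hf l s (t-1) - Hf l (s+1) (t-1))

lemma Hf_self (l : ℕ → ℝ) (i : ℕ) : Hf l i i = 0 := by simp [Hf]

lemma Hf_ge (l : ℕ → ℝ) {i j : ℕ} (h : j ≤ i) : Hf l i j = 0 := by
  simp [Hf, not_lt.mpr h]

lemma sum_inner_cf (l : ℕ → ℝ) (s j : ℕ) (h : s ≤ j) :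
    ∑ t ∈ Finset.Ioc s j, cf l s t = Hf l s j - Hf l (s+1) j := by
  induction j, h using Nat.le_induction with
  | base => simp [Hf_ge]
  | succ j hj ih =>
    rw [Finset.sum_Ioc_succ_top (by omega), ih]
    simp [cf]

lemma sum_cf (l : ℕ → ℝ) (i j : ℕ) (h : i ≤ j) :
    ∑ s ∈ Finset.Ico i j, ∑ t ∈ Finset.Ioc s j, cf l s t = Hf l i j := by
  have h1 : ∑ s ∈ Finset.Ico i j, ∑ t ∈ Finset.Ioc s j, cf l s t
      = ∑ s ∈ Finset.Ico i j, (Hf l s j - Hf l (s+1) j) := by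
    apply Finset.sum_congr rfl
    intro s hs
    exact sum_inner_cf l s j (Finset.mem_Ico.mp hs).2.le
  rw [h1]
  have h2 := Finset.sum_Ico_sub (fun s => Hf l s j) h
  have : ∑ s ∈ Finset.Ico i j, (Hf l s j - Hf l (s+1) j)
      = - ∑ s ∈ Finset.Ico i j, (Hf l (s+1) j - Hf l s j) := by
    rw [← Finset.sum_neg_distrib]; simp
  rw [this, h2]; simp [Hf_self]

lemma Hf_eq (l : ℕ → ℝ) (k i j : ℕ) (h1 : 1 ≤ i) (hj : j < k) :
    Hf l i j = ∑ s ∈ Finset.Ico 1 k, ∑ t ∈ Finset.Ico 1 k,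
      if i ≤ s ∧ s < t ∧ t ≤ j then cf l s t else 0 := by
  rcases le_or_gt i j with h | h
  · rw [← sum_cf l i j h]
    have hsub : Finset.Ico i j ⊆ Finset.Ico 1 k := by
      intro x; simp only [Finset.mem_Ico]; omega
    rw [← Finset.sum_subset hsub]
    · apply Finset.sum_congr rfl
      intro s hs
      rw [Finset.mem_Ico] at hs
      rw [← Finset.sum_filter]
      apply Finset.sum_congr _ (fun _ _ => rfl)
      ext t; simp only [Finset.mem_Ioc, Finset.mem_filter, Finset.mem_Ico]; omega
    · intro s hs hs'
      apply Finset.sum_eq_zero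
      intro t ht
      simp only [Finset.mem_Ico] at *
      rw [if_neg]; omega
  · rw [Hf_ge l h.le]
    symm
    apply Finset.sum_eq_zero; intro s _
    apply Finset.sum_eq_zero; intro t _
    rw [if_neg]; omega

lemma cf_nonneg (l : ℕ → ℝ) (k : ℕ) (hpos : ∀ i, 1 ≤ i → i < k → 0 < l i)
    (hmono : ∀ i j, 1 ≤ i → i ≤ j → j < k → l i ≤ l j)
    (s t : ℕ) (hs : 1 ≤ s) (hst : s < t) (ht : t < k) : 0 ≤ cf l s t := by
  have ps := hpos s hs (by omega)
  have pt := hpos t (by omega) ht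
  have ps1 := hpos (s+1) (by omega) (by omega)
  have pt1 := hpos (t-1) (by omega) (by omega)
  rcases Nat.lt_or_ge (s+1) t with h | h
  · have e1 : Hf l s t = l s / l t + l t / l s - 2 := by
      rw [Hf, if_pos hst]; field_simp; ring
    have e2 : Hf l (s+1) t = l (s+1) / l t + l t / l (s+1) - 2 := by
      rw [Hf, if_pos h]; field_simp; ring
    have e3 : Hf l s (t-1) = l s / l (t-1) + l (t-1) / l s - 2 := by
      rw [Hf, if_pos (by omega)]; field_simp; ring
    have e4 : Hf l (s+1) (t-1) = l (s+1) / l (t-1) + l (t-1) / l (s+1) - 2 := by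
      rcases Nat.lt_or_ge (s+1) (t-1) with h' | h'
      · rw [Hf, if_pos h']; field_simp; ring
      · have : t - 1 = s + 1 := by omega
        rw [this, Hf_self]; field_simp; ring
    have m1 := hmono s (s+1) hs (by omega) (by omega)
    have m2 := hmono (t-1) t (by omega) (by omega) ht
    have i1 : 0 ≤ (l t - l (t-1)) * (1 / l s - 1 / l (s+1)) := by
      apply mul_nonneg (by linarith)
      have := one_div_le_one_div_of_le ps m1
      linarith
    have i2 : 0 ≤ (l (s+1) - l s) * (1 / l (t-1) - 1 / l t) := by
      apply mul_nonneg (by linarith)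
      have := one_div_le_one_div_of_le pt1 m2
      linarith
    have : cf l s t = (l t - l (t-1)) * (1 / l s - 1 / l (s+1))
        + (l (s+1) - l s) * (1 / l (t-1) - 1 / l t) := by
      rw [cf, e1, e2, e3, e4]; ring
    rw [this]; linarith
  · have : t = s + 1 := by omega
    subst this
    simp only [cf, Hf_ge l (le_refl _), Nat.add_sub_cancel]
    rw [Hf_ge l (show s ≤ s + 1 by omega), Hf, if_pos hst]
    have : 0 ≤ (l s - l (s + 1)) ^ 2 / (l s * l (s + 1)) := by positivity
    linarith

lemma comb {N : ℕ} (l : ℕ → ℝ) (k m : ℕ) (hpos : ∀ i, 1 ≤ i → i < k → 0 < l i)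
    (hmono : ∀ i j, 1 ≤ i → i ≤ j → j < k → l i ≤ l j) (hm : 1 ≤ m) (hmk : m ≤ k)
    (W : Fin N → Fin N → ℝ)
    (hW : ∀ s t, 1 ≤ s → s < t → t < k →
      ∑ i : Fin N, ∑ j : Fin N,
        (if (1 ≤ i.val ∧ i.val ≤ s) ∧ (t ≤ j.val ∧ j.val < k) then W i j else 0)
        ≤ (min (m - 1) (min s (k - t)) : ℕ) / 4) :
    ∑ i : Fin N, ∑ j : Fin N, (if 1 ≤ i.val ∧ j.val < k then W i j * Hf l i j else 0)
      ≤ (∑ i ∈ Finset.Icc 1 (m-1), Hf l i (k - i)) / 4 := by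
  have hL : ∑ i : Fin N, ∑ j : Fin N, (if 1 ≤ i.val ∧ j.val < k then W i j * Hf l i j else 0)
      = ∑ s ∈ Finset.Ico 1 k, ∑ t ∈ Finset.Ico 1 k, (if s < t then cf l s t * 
        ∑ i : Fin N, ∑ j : Fin N,
        (if (1 ≤ i.val ∧ i.val ≤ s) ∧ (t ≤ j.val ∧ j.val < k) then W i j else 0) else 0) := by
    have h1 : ∀ i j : Fin N, (if 1 ≤ i.val ∧ j.val < k then W i j * Hf l i j else 0)
        = ∑ s ∈ Finset.Ico 1 k, ∑ t ∈ Finset.Ico 1 k, (if s < t then cf l s t * 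
        (if (1 ≤ i.val ∧ i.val ≤ s) ∧ (t ≤ j.val ∧ j.val < k) then W i j else 0) else 0) := by
      intro i j
      by_cases h : 1 ≤ i.val ∧ j.val < k
      · rw [if_pos h, Hf_eq l k i j h.1 h.2, Finset.mul_sum]
        apply Finset.sum_congr rfl; intro s _
        rw [Finset.mul_sum]
        apply Finset.sum_congr rfl; intro t _
        by_cases h1 : s < t <;> by_cases h2 : i.val ≤ s <;> by_cases h3 : t ≤ j.val <;>
          simp [h1, h2, h3, h.1, h.2, mul_comm]
      · rw [if_neg h]; symm
        apply Finset.sum_eq_zero; intro s _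
        apply Finset.sum_eq_zero; intro t _
        rw [if_neg (show ¬ ((1 ≤ i.val ∧ i.val ≤ s) ∧ (t ≤ j.val ∧ j.val < k)) by tauto)]
        simp
    simp_rw [h1]
    have h2 : ∀ i : Fin N, ∑ j : Fin N, ∑ s ∈ Finset.Ico 1 k, ∑ t ∈ Finset.Ico 1 k, (if s < t then cf l s t * 
        (if (1 ≤ i.val ∧ i.val ≤ s) ∧ (t ≤ j.val ∧ j.val < k) then W i j else 0) else 0)
        = ∑ s ∈ Finset.Ico 1 k, ∑ t ∈ Finset.Ico 1 k, ∑ j : Fin N, (if s < t then cf l s t * 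
        (if (1 ≤ i.val ∧ i.val ≤ s) ∧ (t ≤ j.val ∧ j.val < k) then W i j else 0) else 0) := by
      intro i
      rw [Finset.sum_comm]
      apply Finset.sum_congr rfl; intro s _
      rw [Finset.sum_comm]
    simp_rw [h2]
    rw [Finset.sum_comm]
    apply Finset.sum_congr rfl; intro s _
    rw [Finset.sum_comm]
    apply Finset.sum_congr rfl; intro t _
    by_cases hst : s < t
    · simp only [hst, if_true, Finset.mul_sum]
    · simp [hst]
  have hR : ∑ i ∈ Finset.Icc 1 (m-1), Hf l i (k - i)
      = ∑ s ∈ Finset.Ico 1 k, ∑ t ∈ Finset.Ico 1 k, (if s < t then cf l s t * 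
        ((min (m - 1) (min s (k - t)) : ℕ) : ℝ) else 0) := by
    have h1 : ∀ i ∈ Finset.Icc 1 (m-1), Hf l i (k - i)
        = ∑ s ∈ Finset.Ico 1 k, ∑ t ∈ Finset.Ico 1 k,
          if i ≤ s ∧ s < t ∧ t ≤ k - i then cf l s t else 0 := by
      intro i hi
      rw [Finset.mem_Icc] at hi
      exact Hf_eq l k i (k-i) hi.1 (by omega)
    rw [Finset.sum_congr rfl h1, Finset.sum_comm]
    apply Finset.sum_congr rfl; intro s hs
    rw [Finset.sum_comm]
    apply Finset.sum_congr rfl; intro t ht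
    rw [Finset.mem_Ico] at hs ht
    by_cases hst : s < t
    · simp only [hst, if_true, true_and]
      rw [← Finset.sum_filter, Finset.sum_const]
      have : Finset.filter (fun i => i ≤ s ∧ t ≤ k - i) (Finset.Icc 1 (m-1))
          = Finset.Icc 1 (min (m - 1) (min s (k - t))) := by
        ext i; simp only [Finset.mem_filter, Finset.mem_Icc]; omega
      rw [this, Nat.card_Icc, Nat.add_sub_cancel, nsmul_eq_mul, mul_comm]
    · simp [hst]
  rw [hL, hR, Finset.sum_div]
  apply Finset.sum_le_sum; intro s hs
  rw [Finset.sum_div]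
  apply Finset.sum_le_sum; intro t ht
  rw [Finset.mem_Ico] at hs ht
  by_cases hst : s < t
  · simp only [hst, if_true]
    rw [mul_div_assoc]
    exact mul_le_mul_of_nonneg_left (hW s t hs.1 hst ht.2)
      (cf_nonneg l k hpos hmono s t hs.1 hst ht.2)
  · simp [hst]

lemma cut_bound {N : ℕ} (E : Matrix (Fin N) (Fin N) ℝ) (hE : E.PosSemidef)
    (hE2 : ∀ j, ∑ i, E i j ^ 2 ≤ E j j) (r : ℝ) (hr : E.trace ≤ r)
    (A B : Finset (Fin N)) (hAB : Disjoint A B) :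
    (∑ i ∈ A, ∑ j ∈ B, E i j ^ 2 ≤ A.card / 4) ∧
    (∑ i ∈ A, ∑ j ∈ B, E i j ^ 2 ≤ B.card / 4) ∧
    (∑ i ∈ A, ∑ j ∈ B, E i j ^ 2 ≤ r / 4) := by
  have hsymm : ∀ i j, E i j = E j i := fun i j => by
    have := hE.1.apply i j
    simpa using this.symm
  have hrow : ∀ j, ∀ C : Finset (Fin N), j ∉ C → ∑ i ∈ C, E i j ^ 2 ≤ 1 / 4 := by
    intro j C hj
    have h1 : ∑ i ∈ insert j C, E i j ^ 2 ≤ ∑ i, E i j ^ 2 :=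
      Finset.sum_le_sum_of_subset_of_nonneg (Finset.subset_univ _) (fun _ _ _ => sq_nonneg _)
    rw [Finset.sum_insert hj] at h1
    have := hE2 j
    nlinarith [sq_nonneg (E j j - 1/2)]
  refine ⟨?_, ?_, ?_⟩
  · have : ∑ i ∈ A, ∑ j ∈ B, E i j ^ 2 ≤ ∑ i ∈ A, (1/4 : ℝ) := by
      apply Finset.sum_le_sum; intro i hi
      have := hrow i B (Finset.disjoint_left.mp hAB hi)
      simpa only [hsymm i] using this
    rw [Finset.sum_const, nsmul_eq_mul] at this
    linarith
  · rw [Finset.sum_comm]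
    have : ∑ j ∈ B, ∑ i ∈ A, E i j ^ 2 ≤ ∑ i ∈ B, (1/4 : ℝ) := by
      apply Finset.sum_le_sum; intro i hi
      exact hrow i A (Finset.disjoint_right.mp hAB hi)
    rw [Finset.sum_const, nsmul_eq_mul] at this
    linarith
  · have hh := (hE.hadamard hE).dotProduct_mulVec_nonneg
      (fun i => (if i ∈ A then (1:ℝ) else 0) - (if i ∈ B then 1 else 0))
    have hh' : 0 ≤ ∑ i, ∑ j, E i j ^ 2 * (((if i ∈ A then (1:ℝ) else 0) - (if i ∈ B then 1 else 0)) *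
        ((if j ∈ A then (1:ℝ) else 0) - (if j ∈ B then 1 else 0))) := by
      refine hh.trans_eq ?_
      simp only [dotProduct, mulVec, Finset.mul_sum, Matrix.hadamard_apply]
      apply Finset.sum_congr rfl; intro i _
      apply Finset.sum_congr rfl; intro j _
      simp only [Pi.star_apply, star_trivial]; ring
    have key : ∀ i j, E i j ^ 2 * (((if i ∈ A then (1:ℝ) else 0) - (if i ∈ B then 1 else 0)) *
        ((if j ∈ A then (1:ℝ) else 0) - (if j ∈ B then 1 else 0))) ≤
        E i j ^ 2 - 2 * (if i ∈ A then (if j ∈ B then E i j ^ 2 else 0) else 0)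
          - 2 * (if j ∈ A then (if i ∈ B then E j i ^ 2 else 0) else 0) := by
      intro i j
      have hi : ¬ (i ∈ A ∧ i ∈ B) := fun h => Finset.disjoint_left.mp hAB h.1 h.2
      have hj : ¬ (j ∈ A ∧ j ∈ B) := fun h => Finset.disjoint_left.mp hAB h.1 h.2
      have := sq_nonneg (E i j)
      rw [hsymm j i]
      by_cases h1 : i ∈ A <;> by_cases h2 : i ∈ B <;> by_cases h3 : j ∈ A <;>
        by_cases h4 : j ∈ B <;> simp [h1, h2, h3, h4] at * <;> nlinarith
    have h3 := hh'.trans (Finset.sum_le_sum fun i _ => Finset.sum_le_sum fun j _ => key i j)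
    simp only [Finset.sum_sub_distrib, ← Finset.mul_sum] at h3
    have e1 : ∑ i, ∑ j, (if i ∈ A then (if j ∈ B then E i j ^ 2 else 0) else 0)
        = ∑ i ∈ A, ∑ j ∈ B, E i j ^ 2 := by
      have : ∀ i, ∑ j, (if i ∈ A then (if j ∈ B then E i j ^ 2 else 0) else 0)
        = if i ∈ A then ∑ j ∈ B, E i j ^ 2 else 0 := by
        intro i; split_ifs <;> simp
      simp_rw [this]; simp
    have e2 : ∑ i, ∑ j, (if j ∈ A then (if i ∈ B then E j i ^ 2 else 0) else 0)
        = ∑ i ∈ A, ∑ j ∈ B, E i j ^ 2 := by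
      rw [Finset.sum_comm, e1]
    have e3 : ∑ i, ∑ j, E i j ^ 2 ≤ r := by
      rw [Finset.sum_comm]
      refine (Finset.sum_le_sum fun j _ => hE2 j).trans ?_
      exact hr
    rw [e1, e2] at h3
    linarith

lemma traceBound {N : ℕ} (l : ℕ → ℝ) (k m : ℕ) 
    (hpos : ∀ i, 1 ≤ i → i < N → 0 < l i)
    (hmono : ∀ i j, 1 ≤ i → i ≤ j → j < N → l i ≤ l j) (hm : 1 ≤ m) (hmk : m ≤ k) (hkN : k ≤ N)
    (E : Matrix (Fin N) (Fin N) ℝ) (hE : E.PosSemidef)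
    (hE2 : ∀ j, ∑ i, E i j ^ 2 ≤ E j j) (hr : E.trace ≤ (m:ℝ) - 1) :
    ∑ i : Fin N, ∑ j : Fin N, (if 1 ≤ i.val ∧ 1 ≤ j.val ∧ j.val < k then
        E i j ^ 2 * (l j / l i) else 0)
      ≤ (m : ℝ) - 1 + (∑ i ∈ Finset.Icc 1 (m-1), Hf l i (k - i)) / 4 := by
  have hsymm : ∀ i j, E i j = E j i := fun i j => by
    have := hE.1.apply i j
    simpa using this.symm
  have hc := comb l k m (fun i h1 h2 => hpos i h1 (by omega))
    (fun i j h1 h2 h3 => hmono i j h1 h2 (by omega)) hm hmk (fun i j => E i j ^ 2) (by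
      intro s t hs hst ht
      set A : Finset (Fin N) := Finset.univ.filter (fun i => 1 ≤ i.val ∧ i.val ≤ s) with hA
      set B : Finset (Fin N) := Finset.univ.filter (fun j => t ≤ j.val ∧ j.val < k) with hB
      have hdis : Disjoint A B := by
        rw [Finset.disjoint_left]; intro x; simp only [hA, hB, Finset.mem_filter]; omega
      have cA : A.card ≤ s := by
        have : A.card ≤ (Finset.Icc 1 s).card :=
          Finset.card_le_card_of_injOn (fun i => i.val) (by
            intro x; simp [hA]) (fun x _ y _ h => Fin.ext h)
        simpa using this
      have cB : B.card ≤ k - t := by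
        have : B.card ≤ (Finset.Ico t k).card :=
          Finset.card_le_card_of_injOn (fun i => i.val) (by
            intro x; simp [hB]) (fun x _ y _ h => Fin.ext h)
        simpa using this
      obtain ⟨b1, b2, b3⟩ := cut_bound E hE hE2 _ hr A B hdis
      have e1 : ∑ i : Fin N, ∑ j : Fin N,
        (if (1 ≤ i.val ∧ i.val ≤ s) ∧ (t ≤ j.val ∧ j.val < k) then E i j ^ 2 else 0)
        = ∑ i ∈ A, ∑ j ∈ B, E i j ^ 2 := by
        rw [hA, Finset.sum_filter]
        apply Finset.sum_congr rfl; intro i _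
        rw [hB, Finset.sum_filter]
        by_cases h : (1 ≤ i.val ∧ i.val ≤ s) <;> simp [h]
      rw [e1]
      have cA' : (A.card : ℝ) ≤ s := by exact_mod_cast cA
      have cB' : (B.card : ℝ) ≤ (k - t : ℕ) := by exact_mod_cast cB
      have cm : ((m - 1 : ℕ) : ℝ) = (m : ℝ) - 1 := by push_cast [hm]; ring
      rcases min_choice (m-1) (min s (k-t)) with h | h <;> rw [h]
      · rw [cm]; exact b3
      · rcases min_choice s (k-t) with h | h <;> rw [h]
        · linarith
        · linarith)
  set d : Fin N → Fin N → ℝ := fun i j =>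
    if (1 ≤ i.val ∧ i.val < k) ∧ (1 ≤ j.val ∧ j.val < k) then E i j ^ 2 * ((l j - l i) / l i) else 0 with hd
  have step : ∀ i j : Fin N, (if 1 ≤ i.val ∧ 1 ≤ j.val ∧ j.val < k then
        E i j ^ 2 * (l j / l i) else 0) ≤ E i j ^ 2 + d i j := by
    intro i j
    simp only [hd]
    by_cases hi : 1 ≤ i.val
    · have pi := hpos i hi i.2
      by_cases hj : 1 ≤ j.val ∧ j.val < k
      · rw [if_pos ⟨hi, hj⟩]
        by_cases hik : i.val < k
        · rw [if_pos ⟨⟨hi, hik⟩, hj⟩]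
          apply le_of_eq; field_simp; ring
        · rw [if_neg (by tauto)]
          have := hmono j i hj.1 (by omega) i.2
          have : l j / l i ≤ 1 := by rw [div_le_one pi]; exact this
          nlinarith [sq_nonneg (E i j)]
      · rw [if_neg (by tauto), if_neg (by tauto)]; nlinarith [sq_nonneg (E i j)]
    · rw [if_neg (by tauto), if_neg (by tauto)]; nlinarith [sq_nonneg (E i j)]
  have step2 : ∑ i, ∑ j, d i j = ∑ i : Fin N, ∑ j : Fin N, (if 1 ≤ i.val ∧ j.val < k then E i j ^ 2 * Hf l i j else 0) := by
    set w : Fin N → Fin N → ℝ := fun i j => (if 1 ≤ i.val ∧ j.val < k then E i j ^ 2 * Hf l i j else 0) with hw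
    have p : ∀ i j, d i j + d j i = w i j + w j i := by
      intro i j
      simp only [hd, hw]
      rw [hsymm j i]
      by_cases hK : (1 ≤ i.val ∧ i.val < k) ∧ (1 ≤ j.val ∧ j.val < k)
      · have pi := hpos i hK.1.1 i.2
        have pj := hpos j hK.2.1 j.2
        rw [if_pos hK, if_pos hK.symm, if_pos ⟨hK.1.1, hK.2.2⟩, if_pos ⟨hK.2.1, hK.1.2⟩]
        rcases lt_trichotomy i.val j.val with h | h | h
        · rw [Hf_ge l h.le, Hf, if_pos h]; field_simp; ring
        · rw [Hf_ge l h.le, Hf_ge l h.ge, h]; simp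
        · rw [Hf_ge l h.le, Hf, if_pos h]; field_simp; ring
      · rw [if_neg hK, if_neg (by tauto)]
        have z1 : (if 1 ≤ i.val ∧ j.val < k then E i j ^ 2 * Hf l i j else 0) = 0 := by
          split_ifs with h
          · rw [Hf_ge l (by omega)]; simp
          · rfl
        have z2 : (if 1 ≤ j.val ∧ i.val < k then E i j ^ 2 * Hf l j i else 0) = 0 := by
          split_ifs with h
          · rw [Hf_ge l (by omega)]; simp
          · rfl
        rw [z1, z2]
    have e := Finset.sum_congr (s₁ := Finset.univ) rfl (fun i _ => Finset.sum_congr (s₁ := Finset.univ) rfl (fun j _ => p i j))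
    simp only [Finset.sum_add_distrib] at e
    rw [Finset.sum_comm (f := fun i j => d j i), Finset.sum_comm (f := fun i j => w j i)] at e
    linarith
  have e3 : ∑ i, ∑ j, E i j ^ 2 ≤ (m:ℝ) - 1 := by
    rw [Finset.sum_comm]
    exact (Finset.sum_le_sum fun j _ => hE2 j).trans hr
  refine (Finset.sum_le_sum fun i _ => Finset.sum_le_sum fun j _ => step i j).trans ?_
  simp only [Finset.sum_add_distrib]
  rw [step2]
  linarith

section rot
variable {N : ℕ} (lam : Fin N → ℝ) (μ : ℝ) (p q : Matrix (Fin N) (Fin N) ℝ)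

lemma p_psd (hps : pᵀ = p) (hpp : p * p = p) : p.PosSemidef := by
  have := Matrix.posSemidef_conjTranspose_mul_self p
  rwa [Matrix.conjTranspose_eq_transpose_of_trivial, hps, hpp] at this

lemma rot_id (hμ : 0 < μ) (hps : pᵀ = p) (hq : (p + μ • diagonal lam) * q = p) :
    diagonal lam * q = qᵀ * diagonal lam * q + μ⁻¹ • ((1 - q)ᵀ * p * (1 - q)) := by
  have h1 : p * (1 - q) = μ • (diagonal lam * q) := by
    rw [mul_sub, mul_one]
    nth_rewrite 1 [← hq]
    rw [add_mul, smul_mul_assoc]; abel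
  rw [mul_assoc (1 - q)ᵀ, h1, mul_smul_comm, smul_smul, inv_mul_cancel₀ hμ.ne', one_smul,
    transpose_sub, transpose_one, sub_mul, one_mul, mul_assoc]
  abel

lemma lamq_psd (hμ : 0 < μ) (hlam : 0 ≤ lam) (hps : pᵀ = p) (hpp : p * p = p)
    (hq : (p + μ • diagonal lam) * q = p) :
    (diagonal lam * q).PosSemidef ∧ (diagonal lam * q - qᵀ * diagonal lam * q).PosSemidef := by
  have a1 : (qᵀ * diagonal lam * q).PosSemidef := by
    have := (Matrix.PosSemidef.diagonal hlam).conjTranspose_mul_mul_same q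
    rwa [Matrix.conjTranspose_eq_transpose_of_trivial] at this
  have a2 : (μ⁻¹ • ((1 - q)ᵀ * p * (1 - q))).PosSemidef := by
    have := (p_psd p hps hpp).conjTranspose_mul_mul_same (1 - q)
    rw [Matrix.conjTranspose_eq_transpose_of_trivial] at this
    exact this.smul (inv_nonneg.mpr hμ.le)
  have h := rot_id lam μ p q hμ hps hq
  constructor
  · rw [h]; exact a1.add a2
  · have : diagonal lam * q - qᵀ * diagonal lam * q = μ⁻¹ • ((1 - q)ᵀ * p * (1 - q)) := by
      nth_rewrite 1 [h]; abel
    rw [this]; exact a2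

lemma rot_unit (hμ : 0 < μ) (hlam : 0 ≤ lam) (z0 : Fin N) (hlp : ∀ i, i ≠ z0 → 0 < lam i)
    (hps : pᵀ = p) (hpp : p * p = p) (hp0 : 0 < p z0 z0) :
    IsUnit (p + μ • diagonal lam).det := by
  rw [isUnit_iff_ne_zero]
  intro hdet
  obtain ⟨v, hv, hv0⟩ := Matrix.exists_mulVec_eq_zero_iff.mpr hdet
  apply hv
  have h1 : 0 ≤ v ⬝ᵥ p *ᵥ v := by
    simpa using (p_psd p hps hpp).dotProduct_mulVec_nonneg v
  have h2 : v ⬝ᵥ (diagonal lam) *ᵥ v = ∑ i, lam i * v i ^ 2 := by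
    simp only [dotProduct, mulVec_diagonal]
    apply Finset.sum_congr rfl; intro i _; ring
  have h3 : v ⬝ᵥ p *ᵥ v + μ * ∑ i, lam i * v i ^ 2 = 0 := by
    rw [← h2, ← smul_eq_mul, ← dotProduct_smul, ← smul_mulVec, ← dotProduct_add, ← add_mulVec, hv0]
    simp
  have hnn : ∀ i ∈ Finset.univ, 0 ≤ lam i * v i ^ 2 := fun i _ => mul_nonneg (hlam i) (sq_nonneg _)
  have h4 : 0 ≤ ∑ i, lam i * v i ^ 2 := Finset.sum_nonneg hnn
  have h5 : ∑ i, lam i * v i ^ 2 = 0 := by nlinarith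
  have h6 : v ⬝ᵥ p *ᵥ v = 0 := by rw [h5] at h3; linarith
  rw [Finset.sum_eq_zero_iff_of_nonneg hnn] at h5
  have hvi : ∀ i, i ≠ z0 → v i = 0 := by
    intro i hi
    have := h5 i (Finset.mem_univ _)
    have hl := hlp i hi
    rcases mul_eq_zero.mp this with h | h
    · linarith
    · exact pow_eq_zero_iff (two_ne_zero) |>.mp h
  have h7 : v ⬝ᵥ p *ᵥ v = p z0 z0 * v z0 ^ 2 := by
    simp only [dotProduct, mulVec]
    rw [Finset.sum_eq_single z0, Finset.sum_eq_single z0]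
    · ring
    · intro j _ hj; rw [hvi j hj]; ring
    · simp
    · intro j _ hj; rw [hvi j hj]; ring
    · simp
  rw [h6] at h7
  have hz : v z0 = 0 := by
    rcases mul_eq_zero.mp h7.symm with h | h
    · linarith
    · exact pow_eq_zero_iff (two_ne_zero) |>.mp h
  ext i
  by_cases h : i = z0
  · rw [h, hz]; rfl
  · exact hvi i h

lemma rot_cancel (hu : IsUnit (p + μ • diagonal lam).det) {X Y : Matrix (Fin N) (Fin N) ℝ}
    (h : (p + μ • diagonal lam) * X = (p + μ • diagonal lam) * Y) : X = Y := by
  have := congrArg (fun Z => (p + μ • diagonal lam)⁻¹ * Z) h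
  simpa only [← mul_assoc, Matrix.nonsing_inv_mul _ hu, one_mul] using this

lemma rot_col0 (hu : IsUnit (p + μ • diagonal lam).det) (z0 : Fin N) (hz : lam z0 = 0)
    (hq : (p + μ • diagonal lam) * q = p) (i : Fin N) : q i z0 = if i = z0 then 1 else 0 := by
  have h1 : q * diagonal (Pi.single z0 1) = diagonal (Pi.single z0 1) := by
    apply rot_cancel lam μ p hu
    rw [← mul_assoc, hq, add_mul, smul_mul_assoc, diagonal_mul_diagonal]
    have : (fun i => lam i * (Pi.single z0 1 : Fin N → ℝ) i) = 0 := by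
      ext i
      by_cases h : i = z0
      · subst h; simp [hz]
      · simp [h]
    rw [this]; simp
  have := congrFun (congrFun h1 i) z0
  rw [mul_diagonal] at this
  simp only [Pi.single_eq_same, mul_one] at this
  rw [this]
  by_cases h : i = z0
  · subst h; simp
  · simp [h]

lemma rot_trace (hμ : 0 < μ) (hlam : 0 ≤ lam)
    (hps : pᵀ = p) (hpp : p * p = p) (hu : IsUnit (p + μ • diagonal lam).det)
    (hq : (p + μ • diagonal lam) * q = p) : q.trace ≤ p.trace := by
  have h1 : q * p = q := by
    apply rot_cancel lam μ p hu
    rw [← mul_assoc, hq, hpp]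
  have hs : qᵀ * p = p * q := by
    have e1 : qᵀ * p = qᵀ * (p + μ • diagonal lam) * q := by rw [mul_assoc, hq]
    have e2 : (qᵀ * p)ᵀ = qᵀ * p := by
      rw [e1]
      simp only [transpose_mul, transpose_add, transpose_smul, diagonal_transpose, hps,
        transpose_transpose, mul_assoc]
    rw [← e2]; simp [transpose_mul, hps]
  have h2 : p - p * q = (1 - q)ᵀ * p * (1 - q) + μ • (qᵀ * diagonal lam * q) := by
    have e1 : qᵀ * p * q + μ • (qᵀ * diagonal lam * q) = qᵀ * p := by
      conv_rhs => rw [← hq]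
      rw [add_mul, mul_add, smul_mul_assoc, mul_smul_comm, mul_assoc, mul_assoc]
    have : (1 - q)ᵀ * p * (1 - q) = p - qᵀ * p - p * q + qᵀ * p * q := by
      rw [transpose_sub, transpose_one]; noncomm_ring
    rw [this, add_assoc, e1, hs]; abel
  have a1 : (qᵀ * diagonal lam * q).PosSemidef := by
    have := (Matrix.PosSemidef.diagonal hlam).conjTranspose_mul_mul_same q
    rwa [Matrix.conjTranspose_eq_transpose_of_trivial] at this
  have a2 : ((1 - q)ᵀ * p * (1 - q)).PosSemidef := by
    have := (p_psd p hps hpp).conjTranspose_mul_mul_same (1 - q)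
    rwa [Matrix.conjTranspose_eq_transpose_of_trivial] at this
  have h3 : 0 ≤ (p - p * q).trace := by
    rw [h2]; exact (a2.add (a1.smul hμ.le)).trace_nonneg
  rw [trace_sub] at h3
  have : q.trace = (p * q).trace := by
    rw [trace_mul_comm, h1]
  linarith

/-- Kantorovich bound on the constant component. -/
lemma rot_const (hμ : 0 < μ) (hlam : 0 ≤ lam) (z0 : Fin N) (hz : lam z0 = 0)
    (hps : pᵀ = p) (hpp : p * p = p) (hp0 : 0 < p z0 z0)
    (hq : (p + μ • diagonal lam) * q = p)
    (a b : ℝ) (ha : 0 < a) (hab : a ≤ b) (K : Finset (Fin N)) (hK0 : z0 ∉ K)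
    (hKa : ∀ i, i ≠ z0 → a ≤ lam i) (hKb : ∀ i ∈ K, lam i ≤ b)
    (hKb' : ∀ i, i ≠ z0 → i ∉ K → b ≤ lam i)
    (c : Fin N → ℝ) (hc : ∀ i, i ∉ K → c i = 0) :
    ((q *ᵥ c) z0) ^ 2 ≤ (p z0 z0)⁻¹ * ((a + b) ^ 2 / (4 * a * b)) * ∑ i, c i ^ 2 := by
  have hb : 0 < b := ha.trans_le hab
  set z : Fin N → ℝ := c - q *ᵥ c with hzdef
  have hpz : p *ᵥ z = μ • (diagonal lam *ᵥ (q *ᵥ c)) := by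
    rw [hzdef, mulVec_sub, sub_eq_iff_eq_add]
    nth_rewrite 1 [← hq]
    rw [← mulVec_mulVec, add_mulVec, smul_mulVec, add_comm]
  have hz0 : z z0 = - (q *ᵥ c) z0 := by simp [hzdef, hc z0 hK0]
  have hin : 0 ≤ ∑ i, lam i * (z i * (c i - z i)) := by
    have h1 : 0 ≤ z ⬝ᵥ p *ᵥ z := by
      simpa using (p_psd p hps hpp).dotProduct_mulVec_nonneg z
    rw [hpz, dotProduct_smul, smul_eq_mul] at h1
    have h2 := nonneg_of_mul_nonneg_right h1 hμ
    refine h2.trans_eq ?_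
    simp only [dotProduct, mulVec_diagonal]
    apply Finset.sum_congr rfl; intro i _
    have : c i - z i = (q *ᵥ c) i := by simp [hzdef]
    rw [this]; ring
  set T := ∑ i ∈ Finset.univ.erase z0, z i ^ 2 with hT
  have hTle : T ≤ ((a + b) ^ 2 / (4 * a * b)) * ∑ i, c i ^ 2 := by
    have hin' : 0 ≤ (1/a + 1/b) * ∑ i ∈ Finset.univ.erase z0, lam i * (z i * (c i - z i)) := by
      apply mul_nonneg (by positivity)
      rw [← Finset.add_sum_erase _ _ (Finset.mem_univ z0), hz] at hin
      simpa using hin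
    have hce : ∑ i, c i ^ 2 = ∑ i ∈ Finset.univ.erase z0, c i ^ 2 := by
      rw [← Finset.add_sum_erase _ _ (Finset.mem_univ z0), hc z0 hK0]; simp
    rw [hce]
    refine (le_add_of_nonneg_right hin').trans ?_
    rw [hT, Finset.mul_sum, Finset.mul_sum, ← Finset.sum_add_distrib]
    apply Finset.sum_le_sum
    intro i hi
    have hi0 : i ≠ z0 := Finset.ne_of_mem_erase hi
    have hla := hKa i hi0
    by_cases hiK : i ∈ K
    · have hlb := hKb i hiK
      have hl : 0 < lam i := ha.trans_le hla
      have hrew : z i ^ 2 + (1/a + 1/b) * (lam i * (z i * (c i - z i)))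
          = (4 * a * b * z i ^ 2 + 4 * (a + b) * (lam i * (z i * (c i - z i)))) / (4 * a * b) := by
        field_simp; ring
      rw [hrew, div_mul_eq_mul_div]
      apply div_le_div_of_nonneg_right _ (by positivity)
      have hD : lam i ^ 2 ≤ lam i * (a + b) - a * b := by nlinarith [mul_nonneg (sub_nonneg.2 hla) (sub_nonneg.2 hlb)]
      nlinarith [mul_nonneg (sub_nonneg.2 hD) (sq_nonneg (z i)), sq_nonneg (2 * lam i * z i - (a + b) * c i)]
    · rw [hc i hiK]
      have := hKb' i hi0 hiK
      have h1 : 1 ≤ (1/a + 1/b) * lam i := by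
        have : 1 ≤ 1 / b * lam i := by rw [one_div, ← div_eq_inv_mul, le_div_iff₀ hb]; linarith
        have : 0 ≤ 1 / a * lam i := mul_nonneg (by positivity) (hlam i)
        linarith
      nlinarith [sq_nonneg (z i)]
  have hrow : ∑ i, p z0 i ^ 2 = p z0 z0 := by
    have := congrFun (congrFun hpp z0) z0
    rw [mul_apply] at this
    rw [← this]
    apply Finset.sum_congr rfl; intro i _
    have := congrFun (congrFun hps z0) i
    rw [transpose_apply] at this
    rw [this]; ring
  have hsum : p z0 z0 * z z0 + ∑ i ∈ Finset.univ.erase z0, p z0 i * z i = 0 := by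
    have := congrFun hpz z0
    rw [Pi.smul_apply, mulVec_diagonal, hz] at this
    rw [Finset.add_sum_erase _ (fun i => p z0 i * z i) (Finset.mem_univ z0)]
    simpa [mulVec, dotProduct] using this
  have hcs := Finset.sum_mul_sq_le_sq_mul_sq (Finset.univ.erase z0) (fun i => p z0 i) z
  have hr2 : ∑ i ∈ Finset.univ.erase z0, p z0 i ^ 2 ≤ p z0 z0 := by
    rw [← hrow]
    exact Finset.sum_le_sum_of_subset_of_nonneg (Finset.subset_univ _) (fun _ _ _ => sq_nonneg _)
  have hT0 : 0 ≤ T := Finset.sum_nonneg fun _ _ => sq_nonneg _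
  have h8 : (p z0 z0 * z z0) ^ 2 ≤ p z0 z0 * T := by
    have : p z0 z0 * z z0 = - ∑ i ∈ Finset.univ.erase z0, p z0 i * z i := by linarith
    rw [this, neg_sq]
    exact hcs.trans (mul_le_mul_of_nonneg_right hr2 hT0)
  have h9 : z z0 ^ 2 ≤ (p z0 z0)⁻¹ * T := by
    rw [← div_eq_inv_mul, le_div_iff₀ hp0]
    have : p z0 z0 * (z z0 ^ 2 * p z0 z0) ≤ p z0 z0 * T := by nlinarith
    exact le_of_mul_le_mul_left this hp0
  have h10 : (q *ᵥ c) z0 ^ 2 = z z0 ^ 2 := by rw [hz0]; ring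
  rw [h10, mul_assoc]
  exact h9.trans (mul_le_mul_of_nonneg_left hTle (inv_nonneg.mpr hp0.le))

end rot

lemma rot_core {N : ℕ} (k m : ℕ) (hN : 2 ≤ N) (hk2 : 2 ≤ k) (hkN : k ≤ N) (hm : 1 ≤ m) (hmk : m ≤ k)
    (lam : Fin N → ℝ) (l : ℕ → ℝ) (hl : ∀ i : Fin N, l i.val = lam i)
    (hmono : StrictMono lam) (hlam0 : lam ⟨0, by omega⟩ = 0)
    (μ : ℝ) (hμ : 0 < μ) (p q : Matrix (Fin N) (Fin N) ℝ)
    (hps : pᵀ = p) (hpp : p * p = p)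
    (hp0 : p ⟨0, by omega⟩ ⟨0, by omega⟩ = (m : ℝ) / N) (hpt : p.trace = m)
    (hq : (p + μ • diagonal lam) * q = p) :
    ∑ i : Fin N, ∑ j : Fin N, (if j.val < k then q i j ^ 2 else 0)
      ≤ 1 + (N / m) * ((l 1 + l (k-1)) ^ 2 / (4 * l 1 * l (k-1)))
        + ((m : ℝ) - 1 + (∑ i ∈ Finset.Icc 1 (m-1), Hf l i (k - i)) / 4) := by
  set z0 : Fin N := ⟨0, by omega⟩ with hz0
  have hNpos : (0:ℝ) < N := by exact_mod_cast (by omega : 0 < N)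
  have hmpos : (0:ℝ) < m := by exact_mod_cast (by omega : 0 < m)
  have hp0' : 0 < p z0 z0 := by rw [hp0]; positivity
  have hne : ∀ i : Fin N, i ≠ z0 ↔ 1 ≤ i.val := by
    intro i; rw [ne_eq, Fin.ext_iff]; simp [hz0]; omega
  have hlp : ∀ i, i ≠ z0 → 0 < lam i := by
    intro i hi
    rw [← hlam0]
    apply hmono
    rw [Fin.lt_def]; have := (hne i).1 hi; simp [hz0]; omega
  have hlam : 0 ≤ lam := by
    intro i
    by_cases h : i = z0
    · rw [h, hlam0]; simp
    · exact (hlp i h).le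
  have hu := rot_unit lam μ p hμ hlam z0 hlp hps hpp hp0'
  have hcol := rot_col0 lam μ p q hu z0 hlam0 hq
  have htr := rot_trace lam μ p q hμ hlam hps hpp hu hq
  rw [hpt] at htr
  obtain ⟨hR, hR2⟩ := lamq_psd lam μ p q hμ hlam hps hpp hq
  have hlpos : ∀ i, 1 ≤ i → i < N → 0 < l i := by
    intro i h1 h2
    have := hl ⟨i, h2⟩
    simp only at this
    rw [this]
    apply hlp; rw [hne]; exact h1
  have hlmono : ∀ i j, 1 ≤ i → i ≤ j → j < N → l i ≤ l j := by
    intro i j h1 h2 h3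
    have e1 := hl ⟨i, by omega⟩
    have e2 := hl ⟨j, h3⟩
    simp only at e1 e2
    rw [e1, e2]
    exact hmono.monotone (by simpa using h2)
  set s : Fin N → ℝ := fun i => 1 / Real.sqrt (lam i) with hs
  have hs2 : ∀ i, i ≠ z0 → s i ^ 2 * lam i = 1 := by
    intro i hi
    have := hlp i hi
    simp only [hs]
    rw [div_pow, Real.sq_sqrt this.le]; field_simp
  have hs0 : s z0 = 0 := by simp [hs, hlam0]
  set E : Matrix (Fin N) (Fin N) ℝ := diagonal s * (diagonal lam * q) * diagonal s with hE
  have hEapp : ∀ i j, E i j = s i * (lam i * q i j) * s j := by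
    intro i j
    rw [hE, mul_diagonal, diagonal_mul, diagonal_mul]
  have hEpsd : E.PosSemidef := by
    have := hR.conjTranspose_mul_mul_same (diagonal s)
    rwa [Matrix.conjTranspose_eq_transpose_of_trivial, diagonal_transpose] at this
  have hE2 : ∀ j, ∑ i, E i j ^ 2 ≤ E j j := by
    intro j
    have h1 : 0 ≤ (diagonal lam * q - qᵀ * diagonal lam * q) j j := hR2.diag_nonneg
    have h2 : (qᵀ * diagonal lam * q) j j = ∑ i, lam i * q i j ^ 2 := by
      rw [mul_apply]
      apply Finset.sum_congr rfl; intro i _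
      rw [mul_diagonal, transpose_apply]; ring
    rw [Matrix.sub_apply, h2, diagonal_mul] at h1
    have h3 : ∑ i, E i j ^ 2 = s j ^ 2 * ∑ i, lam i * q i j ^ 2 := by
      rw [Finset.mul_sum]
      apply Finset.sum_congr rfl; intro i _
      rw [hEapp]
      by_cases h : i = z0
      · rw [h, hlam0]; ring
      · have := hs2 i h
        calc (s i * (lam i * q i j) * s j) ^ 2
            = (s i ^ 2 * lam i) * (s j ^ 2 * (lam i * q i j ^ 2)) := by ring
          _ = _ := by rw [this]; ring
    rw [h3, hEapp]
    nlinarith [mul_nonneg (sq_nonneg (s j)) h1]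
  have hEtr : E.trace ≤ (m:ℝ) - 1 := by
    have h1 : q.trace = 1 + E.trace := by
      simp only [trace, diag_apply]
      rw [← Finset.add_sum_erase _ _ (Finset.mem_univ z0),
        ← Finset.add_sum_erase _ (fun i => E i i) (Finset.mem_univ z0)]
      rw [hcol z0, if_pos rfl, hEapp z0 z0, hs0]
      have : ∑ x ∈ Finset.univ.erase z0, q x x = ∑ x ∈ Finset.univ.erase z0, E x x := by
        apply Finset.sum_congr rfl; intro i hi
        have := hs2 i (Finset.ne_of_mem_erase hi)
        rw [hEapp]
        linear_combination (-q i i) * this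
      rw [this]; ring
    linarith
  have htb := traceBound l k m hlpos hlmono hm hmk hkN E hEpsd hE2 hEtr
  set c : Fin N → ℝ := fun j => if 1 ≤ j.val ∧ j.val < k then q z0 j else 0 with hc
  have hcst := rot_const lam μ p q hμ hlam z0 hlam0 hps hpp hp0' hq (l 1) (l (k-1))
    (hlpos 1 le_rfl (by omega)) (hlmono 1 (k-1) le_rfl (by omega) (by omega))
    (Finset.univ.filter fun j => 1 ≤ j.val ∧ j.val < k) (by simp [hz0])
    (by
      intro i hi; rw [← hl i]
      exact hlmono 1 i le_rfl ((hne i).1 hi) i.2)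
    (by
      intro i hi; rw [← hl i]
      rw [Finset.mem_filter] at hi
      exact hlmono i (k-1) hi.2.1 (by omega) (by omega))
    (by
      intro i hi hi'; rw [← hl i]
      have h1 := (hne i).1 hi
      simp only [Finset.mem_filter, Finset.mem_univ, true_and] at hi'
      exact hlmono (k-1) i (by omega) (by omega) i.2)
    c (by
      intro i hi
      simp only [Finset.mem_filter, Finset.mem_univ, true_and] at hi
      simp only [hc]; rw [if_neg hi])
  have hT : (q *ᵥ c) z0 = ∑ i, c i ^ 2 := by
    simp only [mulVec, dotProduct]
    apply Finset.sum_congr rfl; intro j _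
    simp only [hc]; split_ifs <;> ring
  have hpos1 := hlpos 1 le_rfl (by omega)
  have hposk := hlpos (k-1) (by omega) (by omega)
  have hTle : ∑ i, c i ^ 2 ≤ (N / m) * ((l 1 + l (k-1)) ^ 2 / (4 * l 1 * l (k-1))) := by
    rw [hT, hp0, inv_div] at hcst
    have hX : 0 ≤ ((N:ℝ) / m) * ((l 1 + l (k-1)) ^ 2 / (4 * l 1 * l (k-1))) := by positivity
    have hT0 : 0 ≤ ∑ i, c i ^ 2 := Finset.sum_nonneg fun _ _ => sq_nonneg _
    by_contra hcon
    push Not at hcon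
    nlinarith
  have hsplit : ∀ i j : Fin N, (if j.val < k then q i j ^ 2 else 0)
      = (if j = z0 then (if i = z0 then (1:ℝ) else 0) else 0) + (if i = z0 then c j ^ 2 else 0)
        + (if 1 ≤ i.val ∧ 1 ≤ j.val ∧ j.val < k then E i j ^ 2 * (l j / l i) else 0) := by
    intro i j
    by_cases hj : j = z0
    · have hj' : ¬ (1 ≤ j.val) := by rw [← hne]; simpa using hj
      have hj'' : j.val < k := by omega
      have hcj : c j = 0 := by
        simp only [hc]
        rw [if_neg (by tauto)]
      rw [if_pos hj'', if_pos hj, hcj,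
        if_neg (show ¬ (1 ≤ i.val ∧ 1 ≤ j.val ∧ j.val < k) by tauto), hj, hcol i]
      split_ifs <;> simp
    · have hj' := (hne j).1 hj
      rw [if_neg hj]
      by_cases hi : i = z0
      · have hi' : ¬ (1 ≤ i.val) := by rw [← hne]; simpa using hi
        rw [if_pos hi, if_neg (show ¬ (1 ≤ i.val ∧ 1 ≤ j.val ∧ j.val < k) by tauto), hi]
        simp only [hc]
        by_cases h : j.val < k <;> simp [h, hj']
      · have hi' := (hne i).1 hi
        rw [if_neg hi]
        by_cases h : j.val < k
        · rw [if_pos h, if_pos ⟨hi', hj', h⟩, hEapp, hl, hl]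
          have a1 := hs2 i hi
          have a2 := hs2 j hj
          have b1 := hlp i hi
          have : (s i * (lam i * q i j) * s j) ^ 2 * (lam j / lam i)
            = (s i ^ 2 * lam i) * (s j ^ 2 * lam j) * q i j ^ 2 := by
            field_simp
          rw [this, a1, a2]; ring
        · rw [if_neg h, if_neg (by tauto)]; ring
  simp_rw [hsplit, Finset.sum_add_distrib]
  have e1 : ∑ i : Fin N, ∑ j : Fin N, (if j = z0 then (if i = z0 then (1:ℝ) else 0) else 0) = 1 := by
    simp
  have e2 : ∑ i : Fin N, ∑ j : Fin N, (if i = z0 then c j ^ 2 else 0) = ∑ j, c j ^ 2 := by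
    rw [Finset.sum_comm]; simp
  rw [e1, e2]
  linarith

lemma omegaFn_eq {x : ℝ} (hx : 0 < x) : omegaFn x = (x + 1 / x + 2) / 4 := by
  have h := Real.sq_sqrt hx.le
  have h0 := Real.sqrt_pos.mpr hx
  rw [omegaFn]
  have : (Real.sqrt x + 1 / Real.sqrt x) ^ 2 = Real.sqrt x ^ 2 + 1 / Real.sqrt x ^ 2 + 2 := by
    field_simp; ring
  rw [this, h]

lemma omegaFn_ge_one {x : ℝ} (hx : 0 < x) : 1 ≤ omegaFn x := by
  rw [omegaFn_eq hx]
  have : x + 1 / x - 2 = (x - 1) ^ 2 / x := by field_simp; ring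
  have : 0 ≤ (x - 1) ^ 2 / x := by positivity
  linarith

lemma omegaFn_div {a b : ℝ} (ha : 0 < a) (hb : 0 < b) :
    omegaFn (b / a) = (a + b) ^ 2 / (4 * a * b) := by
  rw [omegaFn_eq (by positivity)]; field_simp; ring

lemma two_m_le {N : ℕ} (lam : Fin N → ℝ) (k m : ℕ) (hk2 : 2 ≤ k)
    (hm : m ∈ Finset.Icc 1 N)
    (hmin : ∀ m' ∈ Finset.Icc 1 N, Bbl lam k m ≤ Bbl lam k m')
    (hB : Bbl lam k m < (k : ℝ) - 1) : 2 * m ≤ k := by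
  rw [Finset.mem_Icc] at hm
  obtain ⟨hm1, hmN⟩ := hm
  rcases Nat.lt_or_ge m 2 with h | h
  · omega
  obtain ⟨n, rfl⟩ : ∃ n, m = n + 1 := ⟨m - 1, by omega⟩
  have h1 := hmin n (Finset.mem_Icc.mpr ⟨by omega, by omega⟩)
  have hge : ∀ i, 1 ≤ omegaFn (max 1 (eig1 lam (k + 2 - i) / eig1 lam i)) := fun i =>
    omegaFn_ge_one (lt_of_lt_of_le one_pos (le_max_left _ _))
  have h2 : (n : ℝ) ≤ ∑ i ∈ Finset.Icc 2 (n+1), omegaFn (max 1 (eig1 lam (k + 2 - i) / eig1 lam i)) := by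
    have := Finset.sum_le_sum (fun i (_ : i ∈ Finset.Icc 2 (n+1)) => hge i)
    simpa using this
  have h3 := hge (n+1)
  have h4 : Bbl lam k (n+1) = omegaFn (eig1 lam k / eig1 lam 2) * ((N : ℝ) / ((n + 1 : ℕ) : ℝ)) +
    ∑ i ∈ Finset.Icc 2 (n+1), omegaFn (max 1 (eig1 lam (k + 2 - i) / eig1 lam i)) := rfl
  rw [h4] at hB
  rw [h4, Bbl, Finset.sum_Icc_succ_top (by omega)] at h1
  set x := omegaFn (eig1 lam k / eig1 lam 2)
  have hn : (0:ℝ) < n := by exact_mod_cast (by omega : 0 < n)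
  push_cast at *
  have h5 : x * (N / (n:ℝ)) = x * (N / ((n:ℝ) + 1)) * (1 + 1 / n) := by field_simp
  have h6 : (n:ℝ) ≤ x * (N / ((n:ℝ) + 1)) := by
    have : 1 ≤ x * (N / ((n:ℝ) + 1)) * (1 / n) := by nlinarith
    rw [mul_one_div, le_div_iff₀ hn] at this
    linarith
  have h7 : (2 * (n : ℝ)) < (k:ℝ) - 1 := by linarith
  have : 2 * n + 1 < k := by
    have : ((2 * n + 1 : ℕ) : ℝ) < k := by push_cast; linarith
    exact_mod_cast this
  omega

lemma Bbl_eq {N : ℕ} (lam : Fin N → ℝ) (hmono : StrictMono lam) (hN : 2 ≤ N)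
    (hlam0 : lam ⟨0, by omega⟩ = 0) (k m : ℕ) (hk2 : 2 ≤ k) (hkN : k ≤ N) (hm : 1 ≤ m)
    (hmk : 2 * m ≤ k) :
    Bbl lam k m = (N / m) * ((eig1 lam 2 + eig1 lam k) ^ 2 / (4 * eig1 lam 2 * eig1 lam k))
        + ((m : ℝ) - 1 + (∑ i ∈ Finset.Icc 1 (m-1), Hf (fun n => eig1 lam (n+1)) i (k - i)) / 4) := by
  have hpos : ∀ i, 2 ≤ i → i ≤ N → 0 < eig1 lam i := by
    intro i h1 h2
    rw [eig1, dif_pos (by omega), ← hlam0]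
    apply hmono; rw [Fin.lt_def]; simp; omega
  have hm' : ∀ i j, 2 ≤ i → i ≤ j → j ≤ N → eig1 lam i ≤ eig1 lam j := by
    intro i j h1 h2 h3
    rw [eig1, dif_pos (by omega), eig1, dif_pos (by omega)]
    apply hmono.monotone; rw [Fin.le_def]; simp; omega
  rw [Bbl, omegaFn_div (hpos 2 le_rfl hN) (hpos k hk2 hkN), mul_comm]
  congr 1
  have hsh : Finset.Icc 2 m = (Finset.Icc 1 (m-1)).map (addRightEmbedding 1) := by
    rw [Finset.map_add_right_Icc]; congr 1; omega
  rw [hsh, Finset.sum_map]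
  have : ∀ i ∈ Finset.Icc 1 (m-1), omegaFn (max 1 (eig1 lam (k + 2 - (addRightEmbedding 1) i) /
      eig1 lam ((addRightEmbedding 1) i))) = 1 + Hf (fun n => eig1 lam (n+1)) i (k - i) / 4 := by
    intro i hi
    rw [Finset.mem_Icc] at hi
    simp only [addRightEmbedding_apply]
    have e : k + 2 - (i + 1) = k - i + 1 := by omega
    have p1 := hpos (i+1) (by omega) (by omega)
    have p2 := hpos (k-i+1) (by omega) (by omega)
    have m1 := hm' (i+1) (k-i+1) (by omega) (by omega) (by omega)
    rw [e, max_eq_right (by rw [le_div_iff₀ p1]; linarith), omegaFn_div p1 p2, Hf,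
      if_pos (by omega)]
    field_simp; ring
  rw [Finset.sum_congr rfl this, Finset.sum_add_distrib, ← Finset.sum_div]
  simp [hm]

lemma frobSq_eq {m n : Type*} [Fintype m] [Fintype n] (X : Matrix m n ℝ) :
    frobSq X = ∑ i, ∑ j, X i j ^ 2 := by
  unfold frobSq
  rw [Finset.sum_comm]
  simp only [Matrix.trace, Matrix.diag, Matrix.mul_apply, Matrix.transpose_apply]
  exact Finset.sum_congr rfl fun j _ => Finset.sum_congr rfl fun i _ => by ring

lemma frobSq_nonneg {m n : Type*} [Fintype m] [Fintype n] (X : Matrix m n ℝ) :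
    0 ≤ frobSq X := by
  rw [frobSq_eq]
  exact Finset.sum_nonneg fun i _ => Finset.sum_nonneg fun j _ => sq_nonneg _

lemma frobSq_rot {N k : ℕ} (V : Matrix (Fin N) (Fin N) ℝ) (hV : Vᵀ * V = 1)
    (X : Matrix (Fin N) (Fin k) ℝ) : frobSq (V * X) = frobSq X := by
  unfold frobSq
  rw [transpose_mul, Matrix.mul_assoc, ← Matrix.mul_assoc Vᵀ, hV, Matrix.one_mul]

lemma sum_castLE {N k : ℕ} (hkN : k ≤ N) (f : Fin N → ℝ) :
    ∑ j : Fin k, f (Fin.castLE hkN j) = ∑ j : Fin N, (if j.val < k then f j else 0) := by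
  rw [← Finset.sum_filter]
  apply Finset.sum_bij (fun j _ => Fin.castLE hkN j)
  · intro a _; simp
  · intro a _ b _ h; exact Fin.castLE_injective hkN h
  · intro b hb
    rw [Finset.mem_filter] at hb
    exact ⟨⟨b.val, hb.2⟩, Finset.mem_univ _, by ext; simp⟩
  · intro a _; rfl

lemma xi2_eq {N k : ℕ} (hkN : k ≤ N) (u : Fin N → Fin N → ℝ)
    (V : Matrix (Fin N) (Fin N) ℝ) (hVu : V = Matrix.of u) (hV : Vᵀ * V = 1)
    (A : Matrix (Fin N) (Fin N) ℝ) :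
    frobSq (A * (Matrix.of fun i j => u (Fin.castLE hkN j) i : Matrix (Fin N) (Fin k) ℝ))
      = ∑ i : Fin N, ∑ j : Fin N, (if j.val < k then (V * A * Vᵀ) i j ^ 2 else 0) := by
  rw [← frobSq_rot V hV, frobSq_eq]
  apply Finset.sum_congr rfl
  intro i _
  rw [← sum_castLE hkN (fun j => (V * A * Vᵀ) i j ^ 2)]
  apply Finset.sum_congr rfl
  intro j _
  rw [← Matrix.mul_assoc, Matrix.mul_apply, Matrix.mul_apply]
  subst hVu
  rfl

lemma u0_sq {N : ℕ} (hN : 2 ≤ N) (G : SimpleGraph (Fin N)) [DecidableRel G.Adj]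
    (lam : Fin N → ℝ) (hmono : StrictMono lam) (hlam0 : lam ⟨0, by omega⟩ = 0)
    (u : Fin N → Fin N → ℝ)
    (hortho : ∀ i j, u i ⬝ᵥ u j = if i = j then (1 : ℝ) else 0)
    (heig : ∀ i, (G.lapMatrix ℝ).mulVec (u i) = lam i • u i)
    (hV : (Matrix.of u)ᵀ * Matrix.of u = 1) (s : Fin N) :
    u ⟨0, by omega⟩ s ^ 2 = 1 / N := by
  set z0 : Fin N := ⟨0, by omega⟩ with hz0
  have hNpos : (0:ℝ) < N := by exact_mod_cast (by omega : 0 < N)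
  have hL1 : (G.lapMatrix ℝ) *ᵥ (fun _ => (1:ℝ)) = 0 := G.lapMatrix_mulVec_const_eq_zero (R := ℝ)
  have hz : ∀ i, i ≠ z0 → u i ⬝ᵥ (fun _ => (1:ℝ)) = 0 := by
    intro i hi
    have hpos : 0 < lam i := by
      rw [← hlam0]; apply hmono; rw [Fin.lt_def]
      have : i.val ≠ 0 := fun h => hi (by ext; exact h)
      simp [hz0]; omega
    have h1 : (lam i • u i) ⬝ᵥ (fun _ => (1:ℝ)) = 0 := by
      rw [← heig i, dotProduct_comm, dotProduct_mulVec]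
      have : (fun _ => (1:ℝ)) ᵥ* (G.lapMatrix ℝ) = 0 := by
        rw [← mulVec_transpose, (G.isSymm_lapMatrix (R := ℝ)).eq, hL1]
      rw [this, zero_dotProduct]
    rw [smul_dotProduct, smul_eq_mul] at h1
    exact (mul_eq_zero.mp h1).resolve_left hpos.ne'
  set w := u z0 ⬝ᵥ (fun _ => (1:ℝ)) with hw
  have h1 : ∀ t, u z0 t * w = 1 := by
    intro t
    have h := congrFun (congrArg (fun M => M *ᵥ (fun _ => (1:ℝ))) hV) t
    simp only [one_mulVec, ← mulVec_mulVec] at h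
    rw [mulVec, dotProduct, Finset.sum_eq_single z0] at h
    · exact h
    · intro b _ hb
      have : (Matrix.of u *ᵥ fun _ => (1:ℝ)) b = 0 := hz b hb
      rw [this, mul_zero]
    · simp
  have h2 : ∑ t, u z0 t * u z0 t = 1 := by simpa [dotProduct] using hortho z0 z0
  have h3 : (N:ℝ) = w ^ 2 := by
    have : ∑ t : Fin N, (u z0 t * w) ^ 2 = N := by simp [h1]
    rw [← this]
    calc ∑ t : Fin N, (u z0 t * w) ^ 2 = w ^ 2 * ∑ t, u z0 t * u z0 t := by
          rw [Finset.mul_sum]; exact Finset.sum_congr rfl fun t _ => by ring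
      _ = w ^ 2 := by rw [h2, mul_one]
  rw [eq_div_iff hNpos.ne', h3, ← mul_pow, h1, one_pow]

lemma one_case {N : ℕ} (k : ℕ) (lam : Fin N → ℝ) (hlam : ∀ i, 0 ≤ lam i) (μ : ℝ) (hμ : 0 < μ)
    (q : Matrix (Fin N) (Fin N) ℝ) (hq : (1 + μ • diagonal lam) * q = 1) :
    ∑ i : Fin N, ∑ j : Fin N, (if j.val < k then q i j ^ 2 else 0)
      = ∑ j : Fin N, (if j.val < k then ((1 + μ * lam j)⁻¹) ^ 2 else 0) := by
  have h : ∀ i j, q i j = if i = j then (1 + μ * lam j)⁻¹ else 0 := by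
    intro i j
    have h1 := congrFun (congrFun hq i) j
    rw [Matrix.add_mul, Matrix.one_mul, Matrix.smul_mul, Matrix.add_apply, Matrix.smul_apply,
      diagonal_mul, Matrix.one_apply, smul_eq_mul] at h1
    have hp : 0 < 1 + μ * lam i := by have := mul_nonneg hμ.le (hlam i); linarith
    have h2 : (1 + μ * lam i) * q i j = if i = j then 1 else 0 := by rw [← h1]; ring
    by_cases hij : i = j
    · subst hij
      rw [if_pos rfl] at h2 ⊢
      exact eq_inv_of_mul_eq_one_right h2
    · rw [if_neg hij] at h2 ⊢
      exact (mul_eq_zero.mp h2).resolve_left hp.ne'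
  rw [Finset.sum_comm]
  apply Finset.sum_congr rfl
  intro j _
  rw [Finset.sum_eq_single j]
  · rw [h, if_pos rfl]
  · intro b _ hb
    rw [h, if_neg hb]; simp
  · simp

lemma full_lim {N : ℕ} (k : ℕ) (hkN : k ≤ N) (lam : Fin N → ℝ) (b : ℝ) (hb : b < k) :
    ∃ ε > (0:ℝ), ∀ μ, 0 < μ → μ < ε →
      b < ∑ j : Fin N, (if j.val < k then ((1 + μ * lam j)⁻¹) ^ 2 else 0) := by
  have hc : ContinuousAt (fun μ : ℝ =>
      ∑ j : Fin N, (if j.val < k then ((1 + μ * lam j)⁻¹) ^ 2 else 0)) 0 := by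
    have h2 : ∀ j : Fin N, ContinuousAt (fun μ : ℝ =>
        (if j.val < k then ((1 + μ * lam j)⁻¹) ^ 2 else 0)) 0 := by
      intro j
      split_ifs
      · apply ContinuousAt.pow
        apply ContinuousAt.inv₀
        · fun_prop
        · simp
      · exact continuousAt_const
    exact tendsto_finsetSum _ fun j _ => h2 j
  have h0 : (∑ j : Fin N, (if j.val < k then ((1 + (0:ℝ) * lam j)⁻¹) ^ 2 else 0)) = k := by
    rw [← sum_castLE hkN (fun j => ((1 + (0:ℝ) * lam j)⁻¹) ^ 2)]
    simp
  have := hc.eventually (lt_mem_nhds (a := b) (by simp only [h0]; exact hb))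
  rw [Metric.eventually_nhds_iff] at this
  obtain ⟨ε, hε, h⟩ := this
  refine ⟨ε, hε, fun μ h1 h2 => h ?_⟩
  rw [Real.dist_eq, sub_zero, abs_of_pos h1]
  exact h2

lemma final_step {N : ℕ} (x1 x2 : Finset (Fin N) → ℝ) (b : ℝ) (m : ℕ) (hxi1 : ∀ T, 0 ≤ x1 T)
    (hfull : b < x2 Finset.univ) (hub : ∀ T : Finset (Fin N), T.card = m → x2 T ≤ b) :
    ∃ τ > (0 : ℝ), ∀ SNR, 0 < SNR → SNR < τ → ∀ S : Finset (Fin N), S.card = m →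
      x1 S + (1 / SNR) * x2 S < x1 Finset.univ + (1 / SNR) * x2 Finset.univ := by
  obtain ⟨C, hC0, hCT⟩ : ∃ C : ℝ, 0 ≤ C ∧ ∀ T, x1 T ≤ C :=
    ⟨∑ T : Finset (Fin N), x1 T, Finset.sum_nonneg fun T _ => hxi1 T, fun T =>
      Finset.single_le_sum (f := x1) (fun T _ => hxi1 T) (Finset.mem_univ T)⟩
  have hδ0 : 0 < x2 Finset.univ - b := by linarith
  refine ⟨(x2 Finset.univ - b) / (C + 1), by positivity, fun SNR hs hst S hS => ?_⟩
  have h1 : SNR * (C + 1) < x2 Finset.univ - b := by rwa [lt_div_iff₀ (by linarith)] at hst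
  have h2 : C + 1 < 1 / SNR * (x2 Finset.univ - b) := by
    rw [one_div, ← div_eq_inv_mul, lt_div_iff₀ hs]; linarith
  have h3 : x2 Finset.univ - b ≤ x2 Finset.univ - x2 S := by
    have := hub S hS
    linarith
  have h4 : 1 / SNR * (x2 Finset.univ - b) ≤ 1 / SNR * (x2 Finset.univ - x2 S) :=
    mul_le_mul_of_nonneg_left h3 (by positivity)
  have h5 := hCT S
  have h6 := hxi1 Finset.univ
  rw [mul_sub _ _ (x2 S)] at h4
  linarith

/-- Paper's Theorem 5 (`main_GLR_bl`) for GLR under `k`-bandlimited noise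
(noise variance `σ² = 1/SNR`): if `m_opt_bl` minimises `B_k` over `{1, …, N}` and
`B_k(m_opt_bl) < k − 1`, then `m_opt_bl ≤ ⌈(N+1)/2⌉` and there exists `μ_ub_bl > 0` such
that for every `0 < μ' < μ_ub_bl` there exists `τ > 0` such that for every
`0 < SNR < τ`, any sample set of size `m_opt_bl` is better than full observation. -/
theorem stmt_19 (N k : ℕ) (hN : 2 ≤ N) (hk2 : 2 ≤ k) (hkN : k ≤ N)
    (G : SimpleGraph (Fin N)) [DecidableRel G.Adj] (hG : G.Connected)
    (lam : Fin N → ℝ) (hmono : StrictMono lam) (hlam0 : lam ⟨0, by omega⟩ = 0)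
    (u : Fin N → Fin N → ℝ)
    (hortho : ∀ i j, u i ⬝ᵥ u j = if i = j then (1 : ℝ) else 0)
    (heig : ∀ i, (G.lapMatrix ℝ).mulVec (u i) = lam i • u i)
    (moptbl : ℕ) (hmopt : moptbl ∈ Finset.Icc 1 N)
    (hmin : ∀ m ∈ Finset.Icc 1 N, Bbl lam k moptbl ≤ Bbl lam k m)
    (hB : Bbl lam k moptbl < (k : ℝ) - 1) :
    let L := G.lapMatrix ℝ
    let UK : Matrix (Fin N) (Fin k) ℝ := Matrix.of fun i j => u (Fin.castLE hkN j) i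
    let P : Finset (Fin N) → Matrix (Fin N) (Fin N) ℝ :=
      fun T => Matrix.diagonal fun j => if j ∈ T then 1 else 0
    let xi1 : ℝ → Finset (Fin N) → ℝ :=
      fun μ' T => frobSq (UK - (P T + μ' • L)⁻¹ * P T * UK)
    let xi2bl : ℝ → Finset (Fin N) → ℝ :=
      fun μ' T => frobSq ((P T + μ' • L)⁻¹ * P T * UK)
    moptbl ≤ ⌈((N : ℝ) + 1) / 2⌉₊ ∧
    ∃ μubbl > (0 : ℝ), ∀ μ', 0 < μ' → μ' < μubbl →
      ∃ τ > (0 : ℝ), ∀ SNR, 0 < SNR → SNR < τ →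
        ∀ S : Finset (Fin N), S.card = moptbl →
          xi1 μ' S + (1 / SNR) * xi2bl μ' S <
            xi1 μ' Finset.univ + (1 / SNR) * xi2bl μ' Finset.univ := by
  intro L UK P xi1 xi2bl
  have h2m := two_m_le lam k moptbl hk2 hmopt hmin hB
  have hm1 : 1 ≤ moptbl := (Finset.mem_Icc.mp hmopt).1
  refine ⟨?_, ?_⟩
  · have h1 : (moptbl : ℝ) ≤ ((N:ℝ) + 1) / 2 := by
      have : (2:ℝ) * moptbl ≤ N := by exact_mod_cast h2m.trans hkN
      linarith
    exact_mod_cast h1.trans (Nat.le_ceil _)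
  have hNpos : (0:ℝ) < N := by exact_mod_cast (by omega : 0 < N)
  set z0 : Fin N := ⟨0, by omega⟩ with hz0
  set V : Matrix (Fin N) (Fin N) ℝ := Matrix.of u with hVdef
  have hVV : V * Vᵀ = 1 := by
    ext i j
    rw [Matrix.mul_apply, Matrix.one_apply, ← hortho i j]
    rfl
  have hV : Vᵀ * V = 1 := mul_eq_one_comm.mp hVV
  have hLV : L * Vᵀ = Vᵀ * diagonal lam := by
    ext i j
    rw [mul_diagonal]
    have := congrFun (heig j) i
    rw [Pi.smul_apply, smul_eq_mul] at this
    rw [Matrix.transpose_apply, mul_comm]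
    exact this
  have hlampos : ∀ i, i ≠ z0 → 0 < lam i := by
    intro i hi
    rw [← hlam0]; apply hmono; rw [Fin.lt_def]
    have : i.val ≠ 0 := fun h => hi (by ext; exact h)
    show 0 < i.val
    omega
  have hlamnn : ∀ i, 0 ≤ lam i := by
    intro i
    by_cases hi : i = z0
    · rw [hi]; exact hlam0.ge
    · exact (hlampos i hi).le
  have hrotm : ∀ X Y : Matrix (Fin N) (Fin N) ℝ, (V * X * Vᵀ) * (V * Y * Vᵀ) = V * (X * Y) * Vᵀ := by
    intro X Y
    calc (V * X * Vᵀ) * (V * Y * Vᵀ) = V * X * (Vᵀ * V) * Y * Vᵀ := by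
          simp only [Matrix.mul_assoc]
      _ = _ := by rw [hV]; simp only [Matrix.mul_assoc, Matrix.one_mul]
  have hP2 : ∀ T, P T * P T = P T := by
    intro T
    simp only [P]
    rw [diagonal_mul_diagonal]
    congr 1; ext j; split_ifs <;> simp
  have hPt : ∀ T, (P T)ᵀ = P T := fun T => diagonal_transpose _
  have hp0 : ∀ T, (V * P T * Vᵀ) z0 z0 = (T.card : ℝ) / N := by
    intro T
    rw [Matrix.mul_apply]
    simp only [P, mul_diagonal, Matrix.transpose_apply]
    have : ∀ s, V z0 s * (if s ∈ T then (1:ℝ) else 0) * V z0 s = if s ∈ T then 1 / (N:ℝ) else 0 := by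
      intro s
      have h := u0_sq hN G lam hmono hlam0 u hortho heig hV s
      rw [← h]
      split_ifs
      · rw [sq, mul_one]; rfl
      · simp
    rw [Finset.sum_congr rfl fun s _ => this s]
    simp [div_eq_mul_inv]
  have hpt : ∀ T, (V * P T * Vᵀ).trace = T.card := by
    intro T
    rw [Matrix.trace_mul_comm, ← Matrix.mul_assoc, hV, Matrix.one_mul]
    simp [P, Matrix.trace]
  have hps : ∀ T, (V * P T * Vᵀ)ᵀ = V * P T * Vᵀ := by
    intro T
    rw [transpose_mul, transpose_mul, hPt, transpose_transpose, Matrix.mul_assoc]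
  have hpp : ∀ T, (V * P T * Vᵀ) * (V * P T * Vᵀ) = V * P T * Vᵀ := by
    intro T; rw [hrotm, hP2]
  have hrotL : ∀ μ : ℝ, ∀ T, V * (P T + μ • L) * Vᵀ = V * P T * Vᵀ + μ • diagonal lam := by
    intro μ T
    rw [Matrix.mul_add, Matrix.add_mul, Matrix.mul_smul, Matrix.smul_mul, Matrix.mul_assoc V L,
      hLV, ← Matrix.mul_assoc, hVV, Matrix.one_mul]
  have hunit : ∀ μ : ℝ, 0 < μ → ∀ T : Finset (Fin N), 0 < T.card → IsUnit (P T + μ • L).det := by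
    intro μ hμ T hT
    have h := rot_unit lam μ (V * P T * Vᵀ) hμ hlamnn z0 hlampos (hps T) (hpp T)
      (by rw [hp0]; have : (0:ℝ) < T.card := by exact_mod_cast hT
          positivity)
    rw [← hrotL, det_mul, det_mul] at h
    exact isUnit_of_mul_isUnit_right (isUnit_of_mul_isUnit_left h)
  have hq : ∀ μ : ℝ, 0 < μ → ∀ T : Finset (Fin N), 0 < T.card →
      (V * P T * Vᵀ + μ • diagonal lam) * (V * ((P T + μ • L)⁻¹ * P T) * Vᵀ) = V * P T * Vᵀ := by
    intro μ hμ T hT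
    rw [← hrotL, hrotm, ← Matrix.mul_assoc (P T + μ • L), Matrix.mul_nonsing_inv _ (hunit μ hμ T hT),
      Matrix.one_mul]
  have hxi2 : ∀ μ T, xi2bl μ T = ∑ i : Fin N, ∑ j : Fin N,
      (if j.val < k then (V * ((P T + μ • L)⁻¹ * P T) * Vᵀ) i j ^ 2 else 0) :=
    fun μ T => xi2_eq hkN u V hVdef hV _
  have hub : ∀ μ, 0 < μ → ∀ T : Finset (Fin N), T.card = moptbl →
      xi2bl μ T ≤ 1 + Bbl lam k moptbl := by
    intro μ hμ T hT
    have hl : ∀ i : Fin N, (fun n => eig1 lam (n+1)) i.val = lam i := by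
      intro i
      simp [eig1]
    have h := rot_core k moptbl hN hk2 hkN hm1 (by omega) lam (fun n => eig1 lam (n+1)) hl hmono
      hlam0 μ hμ (V * P T * Vᵀ) (V * ((P T + μ • L)⁻¹ * P T) * Vᵀ) (hps T) (hpp T)
      (by rw [← hT]; exact hp0 T) (by rw [← hT]; exact hpt T) (hq μ hμ T (by omega))
    rw [hxi2, Bbl_eq lam hmono hN hlam0 k moptbl hk2 hkN hm1 h2m]
    have hk1 : k - 1 + 1 = k := by omega
    simp only [hk1] at h
    norm_num at h ⊢
    linarith
  obtain ⟨ε, hε, hlim⟩ := full_lim k hkN lam (1 + Bbl lam k moptbl) (by linarith)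
  refine ⟨ε, hε, fun μ hμ hμε => ?_⟩
  have hfull : 1 + Bbl lam k moptbl < xi2bl μ Finset.univ := by
    have hPu : P Finset.univ = 1 := by simp [P]
    rw [hxi2, one_case k lam hlamnn μ hμ]
    · exact hlim μ hμ hμε
    · have h := hq μ hμ Finset.univ (by simp; omega)
      have h1 : V * P Finset.univ * Vᵀ = 1 := by rw [hPu, Matrix.mul_one, hVV]
      rw [h1] at h
      exact h
  have hxi1 : ∀ T, 0 ≤ xi1 μ T := fun T => frobSq_nonneg _
  exact final_step (xi1 μ) (xi2bl μ) _ moptbl hxi1 hfull (hub μ hμ)
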